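/- For any density operator ρ on H ⊗ H with dim H = n and any 0 < ε ≤ 1/n², the state (1−ε)·I/n² + ε·ρ is separable (un-entangled). -/

import Mathlib

open Matrix Kronecker ComplexOrder

/-- A density operator: positive semidefinite with trace 1. -/
def IsDensity {d : Type*} [Fintype d] (ρ : Matrix d d ℂ) : Prop :=
  ρ.PosSemidef ∧ ρ.trace = 1

/-- A state on `H ⊗ H` is separable if it is a convex combination of product states. -/
def Separable {n : ℕ} (τ : Matrix (Fin n × Fin n) (Fin n × Fin n) ℂ) : Prop :=
  ∃ (m : ℕ) (p : Fin m → ℝ) (A B : Fin m → Matrix (Fin n) (Fin n) ℂ),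
    (∀ i, 0 ≤ p i) ∧ (∑ i, p i = 1) ∧
    (∀ i, IsDensity (A i)) ∧ (∀ i, IsDensity (B i)) ∧
    τ = ∑ i, (p i : ℂ) • (A i ⊗ₖ B i)


/-- The convex cone generated by products of positive semidefinite matrices. -/
def sepCone (n : ℕ) : AddSubmonoid (Matrix (Fin n × Fin n) (Fin n × Fin n) ℂ) :=
  AddSubmonoid.closure {X | ∃ A B : Matrix (Fin n) (Fin n) ℂ,
    A.PosSemidef ∧ B.PosSemidef ∧ X = A ⊗ₖ B}

lemma sepCone_prod {n : ℕ} {A B : Matrix (Fin n) (Fin n) ℂ} (hA : A.PosSemidef)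
    (hB : B.PosSemidef) : A ⊗ₖ B ∈ sepCone n :=
  AddSubmonoid.subset_closure ⟨A, B, hA, hB, rfl⟩

lemma sepCone_smul {n : ℕ} {X : Matrix (Fin n × Fin n) (Fin n × Fin n) ℂ}
    (hX : X ∈ sepCone n) {c : ℝ} (hc : 0 ≤ c) : (c : ℂ) • X ∈ sepCone n := by
  induction hX using AddSubmonoid.closure_induction with
  | mem x hx =>
    obtain ⟨A, B, hA, hB, rfl⟩ := hx
    rw [← smul_kronecker]
    exact sepCone_prod (hA.smul (by exact_mod_cast hc)) hB
  | zero => simp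
  | add x y _ _ hx hy => rw [smul_add]; exact add_mem hx hy

lemma psd_normalize {n : ℕ} {A : Matrix (Fin n) (Fin n) ℂ} (hA : A.PosSemidef) (h0 : A ≠ 0) :
    ∃ (p : ℝ) (D : Matrix (Fin n) (Fin n) ℂ), 0 ≤ p ∧ IsDensity D ∧ A = (p : ℂ) • D := by
  have ht : A.trace ≠ 0 := fun h => h0 (hA.trace_eq_zero_iff.1 h)
  have hn := hA.trace_nonneg
  obtain ⟨p, hp, hp'⟩ : ∃ p : ℝ, 0 ≤ p ∧ (p : ℂ) = A.trace := by
    rw [Complex.le_def] at hn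
    refine ⟨A.trace.re, by simpa using hn.1, Complex.ext (by simp) (by simpa using hn.2)⟩
  rw [← hp'] at ht
  refine ⟨p, ((p⁻¹ : ℝ) : ℂ) • A, hp, ⟨hA.smul ?_, ?_⟩, ?_⟩
  · exact_mod_cast inv_nonneg.2 hp
  · rw [trace_smul, ← hp']; simp only [smul_eq_mul]; push_cast; field_simp
  · rw [smul_smul]; push_cast; rw [mul_inv_cancel₀ ht, one_smul]

lemma sepCone_repr {n : ℕ} {X : Matrix (Fin n × Fin n) (Fin n × Fin n) ℂ}
    (hX : X ∈ sepCone n) : ∃ (m : ℕ) (p : Fin m → ℝ) (A B : Fin m → Matrix (Fin n) (Fin n) ℂ),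
    (∀ i, 0 ≤ p i) ∧ (∀ i, IsDensity (A i)) ∧ (∀ i, IsDensity (B i)) ∧
    X = ∑ i, (p i : ℂ) • (A i ⊗ₖ B i) := by
  induction hX using AddSubmonoid.closure_induction with
  | mem x hx =>
    obtain ⟨A, B, hA, hB, rfl⟩ := hx
    by_cases hA0 : A = 0
    · exact ⟨0, Fin.elim0, Fin.elim0, Fin.elim0, fun i => i.elim0, fun i => i.elim0,
        fun i => i.elim0, by simp [hA0]⟩
    by_cases hB0 : B = 0
    · exact ⟨0, Fin.elim0, Fin.elim0, Fin.elim0, fun i => i.elim0, fun i => i.elim0,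
        fun i => i.elim0, by simp [hB0]⟩
    obtain ⟨p, D, hp, hD, rfl⟩ := psd_normalize hA hA0
    obtain ⟨q, E, hq, hE, rfl⟩ := psd_normalize hB hB0
    exact ⟨1, fun _ => p * q, fun _ => D, fun _ => E, fun _ => mul_nonneg hp hq, fun _ => hD,
      fun _ => hE, by
        simp only [smul_kronecker, kronecker_smul, smul_smul, Fin.sum_univ_one]; push_cast
        rw [mul_comm]⟩
  | zero => exact ⟨0, Fin.elim0, Fin.elim0, Fin.elim0, fun i => i.elim0, fun i => i.elim0,
        fun i => i.elim0, by simp⟩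
  | add x y _ _ hx hy =>
    obtain ⟨m, p, A, B, h1, h2, h3, rfl⟩ := hx
    obtain ⟨m', p', A', B', h1', h2', h3', rfl⟩ := hy
    refine ⟨m + m', Fin.append p p', Fin.append A A', Fin.append B B', ?_, ?_, ?_, ?_⟩
    · intro i; refine Fin.addCases (fun i => ?_) (fun i => ?_) i <;> simp [h1, h1']
    · intro i; refine Fin.addCases (fun i => ?_) (fun i => ?_) i <;> simp [h2, h2']
    · intro i; refine Fin.addCases (fun i => ?_) (fun i => ?_) i <;> simp [h3, h3']
    · simp [Fin.sum_univ_add]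

lemma separable_of_sepCone {n : ℕ} {X : Matrix (Fin n × Fin n) (Fin n × Fin n) ℂ}
    (hX : X ∈ sepCone n) (ht : X.trace = 1) : Separable X := by
  obtain ⟨m, p, A, B, h1, h2, h3, rfl⟩ := sepCone_repr hX
  refine ⟨m, p, A, B, h1, ?_, h2, h3, rfl⟩
  rw [trace_sum] at ht
  simp only [trace_smul, trace_kronecker, (h2 _).2, (h3 _).2, smul_eq_mul, mul_one] at ht
  exact_mod_cast ht

lemma weights {n : ℕ} (hn : 0 < n) (y : Fin n → ℝ) (hy : ∀ i, 0 ≤ y i) (hT : 0 < ∑ i, y i) :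
    ∃ b : Fin n → ℝ, (∀ i, 0 < b i) ∧
      ∀ p, ∑ k, (if k = p then 0 else b p / b k) * y k ≤ (1 - 1 / (n : ℝ)) * ∑ i, y i := by
  set T := ∑ i, y i with hTdef
  set l : ℝ := 1 - 1 / (n : ℝ) with hl
  have hn' : (0 : ℝ) < n := by exact_mod_cast hn
  have hn1 : (1 : ℝ) ≤ n := by exact_mod_cast hn
  have hl0 : 0 ≤ l := by
    rw [hl, sub_nonneg, div_le_one hn']; exact hn1
  have hpos : ∀ i, 0 < l * T + y i := by
    intro i
    rcases Nat.lt_or_ge 1 n with h | h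
    · have : 0 < l := by
        rw [hl, sub_pos, div_lt_one hn']; exact_mod_cast h
      have := hy i
      positivity
    · obtain rfl : n = 1 := by omega
      have : T = y i := by
        rw [hTdef, Fin.sum_univ_one, Subsingleton.elim i 0]
      have h2 : 0 ≤ l * T := by positivity
      linarith
  refine ⟨fun i => l * T + y i, hpos, fun p => ?_⟩
  have key : ∑ k, y k / (l * T + y k) ≤ 1 := by
    have : ∀ k, y k / (l * T + y k) ≤ 1 - 2 * l + l * (l * T + y k) / T := by
      intro k
      have hu := hpos k
      set u := l * T + y k
      have hyk : y k = u - l * T := by simp [u]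
      rw [hyk, div_le_iff₀ hu]
      have : (1 - 2 * l + l * u / T) * u - (u - l * T) = l * (u - T) ^ 2 / T := by
        field_simp; ring
      have h2 : 0 ≤ l * (u - T) ^ 2 / T := by positivity
      linarith
    refine (Finset.sum_le_sum fun k _ => this k).trans (le_of_eq ?_)
    rw [Finset.sum_add_distrib, ← Finset.sum_div, ← Finset.mul_sum, Finset.sum_add_distrib,
      ← hTdef]
    simp only [Finset.sum_const, Finset.card_univ, Fintype.card_fin, nsmul_eq_mul]
    rw [hl]
    field_simp
    ring
  clear_value l T
  have e : ∑ k : Fin n, (if k = p then 0 else (l * T + y p) / (l * T + y k)) * y k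
      = (l * T + y p) * (∑ k : Fin n, y k / (l * T + y k)) - y p := by
    have h1 : ∑ k : Fin n, (if k = p then y k else 0) = y p := by simp
    rw [Finset.mul_sum, eq_sub_iff_add_eq]
    conv_lhs => arg 2; rw [← h1]
    rw [← Finset.sum_add_distrib]
    refine Finset.sum_congr rfl fun k _ => ?_
    have := hpos k
    split_ifs with h
    · subst h; field_simp; ring
    · field_simp; ring
  rw [e]
  have := mul_le_mul_of_nonneg_left key (hpos p).le
  linarith

lemma char_sum {n : ℕ} (i j k l : Fin n) :
    ∑ g : Fin n → ZMod 3, (ZMod.stdAddChar (g i - g j - g k + g l) : ℂ)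
      = if (i = k ∧ j = l) ∨ (i = j ∧ k = l) then (3 : ℂ) ^ n else 0 := by
  split_ifs with h
  · have : ∀ g : Fin n → ZMod 3, g i - g j - g k + g l = 0 := by
      intro g
      rcases h with ⟨rfl, rfl⟩ | ⟨rfl, rfl⟩ <;> ring
    simp [this, ZMod.card]
  · let f : (Fin n → ZMod 3) →+ ZMod 3 :=
      { toFun := fun g => g i - g j - g k + g l
        map_zero' := by simp
        map_add' := fun a b => by simp only [Pi.add_apply]; ring }
    let ψ : AddChar (Fin n → ZMod 3) ℂ := (ZMod.stdAddChar (N := 3)).compAddMonoidHom f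
    have hψ : ψ ≠ 0 := by
      intro h0
      have hf : ∀ g, f g = 0 := by
        intro g
        have : ψ g = 1 := by rw [h0]; rfl
        apply ZMod.injective_stdAddChar
        rw [AddChar.map_zero_eq_one]
        exact this
      have h1 := hf (Pi.single i 1)
      have h2 := hf (Pi.single k 1)
      have h3 := hf (Pi.single j 1)
      have d1 : (1 : ZMod 3) ≠ 0 := by decide
      have d2 : (1 : ZMod 3) + 1 ≠ 0 := by decide
      simp only [f, AddMonoidHom.coe_mk, ZeroHom.coe_mk, Pi.single_apply] at h1 h2 h3
      grind
    exact AddChar.sum_eq_zero_iff_ne_zero.2 hψ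

/-- The `k`-th row of a bipartite vector. -/
def rowVec {n : ℕ} (ψ : Fin n × Fin n → ℂ) (k : Fin n) : Fin n → ℂ := fun j => ψ (k, j)

lemma rank_one_le {n : ℕ} (v : Fin n → ℂ) :
    (((∑ j, ‖v j‖ ^ 2 : ℝ) : ℂ) • (1 : Matrix (Fin n) (Fin n) ℂ)
      - vecMulVec v (star v)).PosSemidef := by
  refine .of_dotProduct_mulVec_nonneg ?_ fun x => ?_
  · refine IsHermitian.sub ?_ (posSemidef_vecMulVec_self_star v).1
    exact (PosSemidef.one.smul (α := ℂ) (by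
      exact_mod_cast Finset.sum_nonneg fun j _ => sq_nonneg ‖v j‖)).1
  · have e1 : ∀ w : Fin n → ℂ, star w ⬝ᵥ w = ((‖WithLp.toLp 2 w‖ ^ 2 : ℝ) : ℂ) := by
      intro w
      rw [EuclideanSpace.norm_sq_eq]
      simp [dotProduct, ← Complex.conj_mul']
    have e2 : star x ⬝ᵥ v = inner ℂ (WithLp.toLp 2 x) (WithLp.toLp 2 v) := by
      simp [EuclideanSpace.inner_eq_star_dotProduct, dotProduct_comm]
    have e3 : star v ⬝ᵥ x = star (star x ⬝ᵥ v) := by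
      simp only [dotProduct, star_sum, star_mul', Pi.star_apply, star_star, mul_comm]
    have hcs := norm_inner_le_norm (𝕜 := ℂ) (WithLp.toLp 2 x) (WithLp.toLp 2 v)
    rw [sub_mulVec, dotProduct_sub, smul_mulVec, one_mulVec, dotProduct_smul, e1,
      vecMulVec_mulVec, dotProduct_smul, e3, e2]
    have e4 : (∑ j, ‖v j‖ ^ 2 : ℝ) = ‖WithLp.toLp 2 v‖ ^ 2 := by
      rw [EuclideanSpace.norm_sq_eq]
    rw [e4]
    set z : ℂ := inner ℂ (WithLp.toLp 2 x) (WithLp.toLp 2 v)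
    have e5 : MulOpposite.op (star z) • z = ((‖z‖ ^ 2 : ℝ) : ℂ) := by
      simp [← Complex.mul_conj']
    rw [e5, smul_eq_mul, ← Complex.ofReal_mul, ← Complex.ofReal_sub]
    have : ‖z‖ ^ 2 ≤ ‖WithLp.toLp 2 v‖ ^ 2 * ‖WithLp.toLp 2 x‖ ^ 2 := by
      rw [← mul_pow, mul_comm]
      gcongr
    exact_mod_cast sub_nonneg.2 this

/-- First factor of the averaged product vectors. -/
noncomputable def leftVec {n : ℕ} (a : Fin n → ℝ) (g : Fin n → ZMod 3) : Fin n → ℂ :=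
  fun i => ZMod.stdAddChar (g i) * (a i : ℂ)

/-- Second factor of the averaged product vectors. -/
noncomputable def rightVec {n : ℕ} (a : Fin n → ℝ) (ψ : Fin n × Fin n → ℂ)
    (g : Fin n → ZMod 3) : Fin n → ℂ :=
  fun j => ∑ k, ZMod.stdAddChar (-(g k)) * ((a k : ℂ)⁻¹ * ψ (k, j))

/-- The noise term in the averaging identity. -/
noncomputable def noise {n : ℕ} (b : Fin n → ℝ) (ψ : Fin n × Fin n → ℂ) (p : Fin n) :
    Matrix (Fin n) (Fin n) ℂ :=
  ∑ k, (((if k = p then 0 else b p / b k) : ℝ) : ℂ) •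
    vecMulVec (rowVec ψ k) (star (rowVec ψ k))

lemma average {n : ℕ} (a : Fin n → ℝ) (ha : ∀ i, 0 < a i) (ψ : Fin n × Fin n → ℂ) :
    ∑ g : Fin n → ZMod 3, vecMulVec (leftVec a g) (star (leftVec a g)) ⊗ₖ
        vecMulVec (rightVec a ψ g) (star (rightVec a ψ g))
      = ((3 : ℂ) ^ n) • (vecMulVec ψ (star ψ) +
        ∑ p, Matrix.single p p (1 : ℂ) ⊗ₖ noise (fun i => a i ^ 2) ψ p) := by
  have ha' : ∀ i, (a i : ℂ) ≠ 0 := fun i => by exact_mod_cast (ha i).ne'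
  ext ⟨p, q⟩ ⟨r, s⟩
  have L : (∑ g : Fin n → ZMod 3, vecMulVec (leftVec a g) (star (leftVec a g)) ⊗ₖ
        vecMulVec (rightVec a ψ g) (star (rightVec a ψ g))) (p, q) (r, s)
      = ∑ k, ∑ l, (a p * a r * (a k : ℂ)⁻¹ * (a l : ℂ)⁻¹ * ψ (k, q) * star (ψ (l, s))) *
          ∑ g : Fin n → ZMod 3, (ZMod.stdAddChar (g p - g r - g k + g l) : ℂ) := by
    simp only [Finset.mul_sum]
    rw [Matrix.sum_apply]
    simp_rw [Finset.sum_comm (s := (Finset.univ : Finset (Fin n)))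
      (t := (Finset.univ : Finset (Fin n → ZMod 3)))]
    refine Finset.sum_congr rfl fun g _ => ?_
    simp only [kroneckerMap_apply, vecMulVec_apply, leftVec, rightVec, Pi.star_apply, star_sum,
      star_mul', Finset.sum_mul, Finset.mul_sum]
    rw [Finset.sum_comm]
    refine Finset.sum_congr rfl fun k _ => Finset.sum_congr rfl fun l _ => ?_
    have hs : ∀ x : ZMod 3, star (ZMod.stdAddChar x : ℂ) = ZMod.stdAddChar (-x) := by
      intro x; rw [AddChar.map_neg_eq_conj]; rfl
    have hr : ∀ x : ℝ, star (x : ℂ) = x := fun x => Complex.conj_ofReal x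
    have hr' : ∀ x : ℝ, star ((x : ℂ)⁻¹) = (x : ℂ)⁻¹ := fun x => by
      rw [← Complex.ofReal_inv]; exact hr _
    rw [hs, hs, hr, hr', neg_neg, AddChar.map_add_eq_mul, sub_eq_add_neg, sub_eq_add_neg,
      AddChar.map_add_eq_mul, AddChar.map_add_eq_mul]
    ring
  rw [L]
  simp only [char_sum]
  have R : (∑ p, Matrix.single p p (1 : ℂ) ⊗ₖ noise (fun i => a i ^ 2) ψ p) (p, q) (r, s)
      = if p = r then noise (fun i => a i ^ 2) ψ p q s else 0 := by
    rw [Matrix.sum_apply]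
    simp only [kroneckerMap_apply, Matrix.single_apply]
    split_ifs with h
    · subst h; simp
    · refine Finset.sum_eq_zero fun x _ => ?_
      rw [if_neg (by rintro ⟨rfl, rfl⟩; exact h rfl), zero_mul]
  rw [Matrix.smul_apply, Matrix.add_apply, R, vecMulVec_apply, smul_eq_mul, Pi.star_apply]
  by_cases h : p = r
  · subst h
    simp only [if_true, noise, Matrix.sum_apply, Matrix.smul_apply, vecMulVec_apply, rowVec,
      Pi.star_apply, smul_eq_mul, true_and]
    have : ∀ k, ∑ l, (a p * a p * (a k : ℂ)⁻¹ * (a l : ℂ)⁻¹ * ψ (k, q) * star (ψ (l, s))) *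
        (if p = k ∧ p = l ∨ k = l then (3 : ℂ) ^ n else 0)
        = (3 : ℂ) ^ n * ((if k = p then ψ (p, q) * star (ψ (p, s)) else 0) +
          (((if k = p then 0 else a p ^ 2 / a k ^ 2) : ℝ) : ℂ) *
            (ψ (k, q) * star (ψ (k, s)))) := by
      intro k
      rw [Finset.sum_eq_single k]
      · have := ha' k
        by_cases hk : k = p
        · subst hk; simp; field_simp
        · simp [hk]; field_simp
      · intro l _ hl
        rw [if_neg, mul_zero]
        rintro (⟨rfl, rfl⟩ | rfl) <;> exact hl rfl
      · simp
    simp only [this, ← Finset.mul_sum, Finset.sum_add_distrib]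
    simp
  · simp only [h, false_and, or_false, if_false, add_zero]
    rw [Finset.sum_eq_single p, Finset.sum_eq_single r]
    · have := ha' p
      have := ha' r
      simp; field_simp
    · intro l _ hl
      rw [if_neg (fun h => hl h.2.symm), mul_zero]
    · simp
    · intro k _ hk
      refine Finset.sum_eq_zero fun l _ => ?_
      rw [if_neg (fun h => hk h.1.symm), mul_zero]
    · simp

lemma single_psd {n : ℕ} (p : Fin n) : (Matrix.single p p (1 : ℂ)).PosSemidef := by
  have : Matrix.single p p (1 : ℂ) = vecMulVec (Pi.single p 1) (star (Pi.single p 1)) := by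
    ext i j
    simp only [Matrix.single_apply, vecMulVec_apply, Pi.star_apply, Pi.single_apply]
    by_cases h1 : i = p <;> by_cases h2 : j = p <;> simp [h1, h2, Ne.symm, @eq_comm _ p]
  rw [this]
  exact posSemidef_vecMulVec_self_star _

lemma pure_mem {n : ℕ} (hn : 0 < n) (ψ : Fin n × Fin n → ℂ) (t : ℝ) (ht : 1 - 1 / (n : ℝ) ≤ t) :
    vecMulVec ψ (star ψ) + ((t * ∑ x, ‖ψ x‖ ^ 2 : ℝ) : ℂ) • 1 ∈ sepCone n := by
  set y : Fin n → ℝ := fun k => ∑ j, ‖rowVec ψ k j‖ ^ 2 with hy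
  have hy0 : ∀ k, 0 ≤ y k := fun k => Finset.sum_nonneg fun j _ => sq_nonneg _
  have hT : ∑ x, ‖ψ x‖ ^ 2 = ∑ k, y k := by
    rw [Fintype.sum_prod_type]; rfl
  rw [hT]
  rcases (Finset.sum_nonneg fun k _ => hy0 k : 0 ≤ ∑ k, y k).eq_or_lt with h0 | hpos
  · have hψ : ψ = 0 := by
      rw [← h0] at hT
      rw [Finset.sum_eq_zero_iff_of_nonneg (fun _ _ => sq_nonneg _)] at hT
      funext x
      simpa using hT x (Finset.mem_univ x)
    rw [← h0, hψ]
    simp [vecMulVec_zero, (sepCone n).zero_mem]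
  obtain ⟨b, hb, hbw⟩ := weights hn y hy0 hpos
  have hsq : (fun i => Real.sqrt (b i) ^ 2) = b := funext fun i => Real.sq_sqrt (hb i).le
  have key := average (fun i => Real.sqrt (b i)) (fun i => Real.sqrt_pos.2 (hb i)) ψ
  simp only [Real.sq_sqrt (hb _).le] at key
  have hone : (1 : Matrix (Fin n × Fin n) (Fin n × Fin n) ℂ)
      = ∑ p, Matrix.single p p (1 : ℂ) ⊗ₖ (1 : Matrix (Fin n) (Fin n) ℂ) := by
    rw [← one_kronecker_one]
    ext ⟨p, q⟩ ⟨r, s⟩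
    rw [Matrix.sum_apply]
    simp only [kroneckerMap_apply, ← Finset.sum_mul, Matrix.single_apply]
    congr 1
    by_cases h : p = r
    · subst h; simp
    · rw [Matrix.one_apply_ne h, Finset.sum_eq_zero]
      intro x _
      rw [if_neg (by rintro ⟨rfl, rfl⟩; exact h rfl)]
  have hid : vecMulVec ψ (star ψ) + ((t * ∑ k, y k : ℝ) : ℂ) • 1
      = ((((3 : ℝ) ^ n)⁻¹ : ℝ) : ℂ) • (∑ g : Fin n → ZMod 3,
          vecMulVec (leftVec (fun i => Real.sqrt (b i)) g)
            (star (leftVec (fun i => Real.sqrt (b i)) g)) ⊗ₖ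
          vecMulVec (rightVec (fun i => Real.sqrt (b i)) ψ g)
            (star (rightVec (fun i => Real.sqrt (b i)) ψ g)))
        + ∑ p, Matrix.single p p (1 : ℂ) ⊗ₖ
            (((t * ∑ k, y k : ℝ) : ℂ) • (1 : Matrix (Fin n) (Fin n) ℂ) - noise b ψ p) := by
    rw [key, smul_smul]
    have : ((((3 : ℝ) ^ n)⁻¹ : ℝ) : ℂ) * 3 ^ n = 1 := by push_cast; field_simp
    rw [this, one_smul, hone, Finset.smul_sum, add_assoc, ← Finset.sum_add_distrib]
    congr 1
    refine Finset.sum_congr rfl fun p _ => ?_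
    rw [← kronecker_add, add_sub_cancel, kronecker_smul]
  rw [hid]
  refine add_mem (sepCone_smul (sum_mem fun g _ => sepCone_prod
    (posSemidef_vecMulVec_self_star _) (posSemidef_vecMulVec_self_star _)) (by positivity))
    (sum_mem fun p _ => sepCone_prod (single_psd p) ?_)
  set c : Fin n → ℝ := fun k => if k = p then 0 else b p / b k with hc
  have hc0 : ∀ k, 0 ≤ c k := fun k => by
    simp only [hc]; split_ifs
    · exact le_rfl
    · exact (div_pos (hb p) (hb k)).le
  have hdec : ((t * ∑ k, y k : ℝ) : ℂ) • (1 : Matrix (Fin n) (Fin n) ℂ) - noise b ψ p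
      = ∑ k, (c k : ℂ) • ((y k : ℂ) • (1 : Matrix (Fin n) (Fin n) ℂ)
          - vecMulVec (rowVec ψ k) (star (rowVec ψ k)))
        + ((t * ∑ k, y k - ∑ k, c k * y k : ℝ) : ℂ) • (1 : Matrix (Fin n) (Fin n) ℂ) := by
    simp only [smul_sub, Finset.sum_sub_distrib, smul_smul, ← Finset.sum_smul, noise]
    push_cast
    rw [sub_smul]
    abel
  rw [hdec]
  refine PosSemidef.add (posSemidef_sum _ fun k _ => (rank_one_le (rowVec ψ k)).smul ?_)
    (PosSemidef.one.smul ?_)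
  · exact_mod_cast hc0 k
  · have h1 : ∑ k, c k * y k ≤ t * ∑ k, y k :=
      (hbw p).trans (mul_le_mul_of_nonneg_right ht hpos.le)
    exact_mod_cast sub_nonneg.2 h1

lemma psd_decomp {d : Type*} [Fintype d] [DecidableEq d] {ρ : Matrix d d ℂ}
    (h : ρ.PosSemidef) : ∃ B : Matrix d d ℂ, ρ = Bᴴ * B := by
  open scoped MatrixOrder Matrix.Norms.L2Operator in
  exact CStarAlgebra.nonneg_iff_eq_star_mul_self.mp h.nonneg

lemma mixed_mem {n : ℕ} (hn : 0 < n) (ρ : Matrix (Fin n × Fin n) (Fin n × Fin n) ℂ)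
    (hρ : IsDensity ρ) (t : ℝ) (ht : 1 - 1 / (n : ℝ) ≤ t) :
    ρ + (t : ℂ) • 1 ∈ sepCone n := by
  obtain ⟨B, hB⟩ := psd_decomp hρ.1
  have e : ρ = ∑ m, vecMulVec (star (B m)) (star (star (B m))) := by
    rw [hB]
    ext x y
    simp [Matrix.sum_apply, Matrix.mul_apply, vecMulVec_apply]
  have e2 : ∑ m, ∑ x, ‖star (B m) x‖ ^ 2 = 1 := by
    have := hρ.2
    rw [hB, Matrix.trace] at this
    simp only [diag_apply, Matrix.mul_apply, conjTranspose_apply] at this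
    rw [Finset.sum_comm] at this
    have h : ((∑ m, ∑ x, ‖star (B m) x‖ ^ 2 : ℝ) : ℂ) = 1 := by
      rw [← this]
      push_cast
      refine Finset.sum_congr rfl fun m _ => Finset.sum_congr rfl fun x _ => ?_
      rw [Pi.star_apply, norm_star, ← Complex.conj_mul']
      rfl
    exact_mod_cast h
  have : ρ + (t : ℂ) • 1 = ∑ m, (vecMulVec (star (B m)) (star (star (B m))) +
      ((t * ∑ x, ‖star (B m) x‖ ^ 2 : ℝ) : ℂ) • 1) := by
    rw [Finset.sum_add_distrib, ← e, ← Finset.sum_smul, ← Complex.ofReal_sum, ← Finset.mul_sum,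
      e2, mul_one]
  rw [this]
  exact sum_mem fun m _ => pure_mem hn _ t ht

theorem maximally_mixed_ball_separable
    {n : ℕ} (hn : 0 < n) (ρ : Matrix (Fin n × Fin n) (Fin n × Fin n) ℂ)
    (hρ : IsDensity ρ) (ε : ℝ) (hε : 0 < ε) (hε' : ε ≤ 1 / (n ^ 2 : ℝ)) :
    Separable ((((1 - ε) / (n ^ 2 : ℝ) : ℝ) : ℂ) •
        (1 : Matrix (Fin n × Fin n) (Fin n × Fin n) ℂ) + ((ε : ℝ) : ℂ) • ρ) := by

  have hn' : (0 : ℝ) < n := by exact_mod_cast hn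
  have hn1 : (1 : ℝ) ≤ n := by exact_mod_cast hn
  have hN : (0 : ℝ) < (n : ℝ) ^ 2 := by positivity
  have hεN : ε * (n : ℝ) ^ 2 ≤ 1 := by rwa [le_div_iff₀ hN] at hε'
  apply separable_of_sepCone
  · have ht : 1 - 1 / (n : ℝ) ≤ (1 - ε) / (n : ℝ) ^ 2 / ε := by
      have h1 : 1 - 1 / (n : ℝ) ^ 2 ≤ (1 - ε) / (n : ℝ) ^ 2 / ε := by
        rw [div_div, le_div_iff₀ (by positivity)]
        have : (1 - 1 / (n : ℝ) ^ 2) * ((n : ℝ) ^ 2 * ε) = ε * (n : ℝ) ^ 2 - ε := by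
          field_simp
        linarith
      have h2 : 1 / (n : ℝ) ^ 2 ≤ 1 / (n : ℝ) := by
        apply one_div_le_one_div_of_le hn'
        nlinarith
      linarith
    have := sepCone_smul (mixed_mem hn ρ hρ _ ht) hε.le
    rw [smul_add, smul_smul, ← Complex.ofReal_mul, mul_div_cancel₀ _ hε.ne', add_comm] at this
    exact this
  · rw [trace_add, trace_smul, trace_smul, hρ.2, trace_one]
    simp only [Fintype.card_prod, Fintype.card_fin, smul_eq_mul]
    have : (n : ℂ) ≠ 0 := by exact_mod_cast hn.ne'
    push_cast
    field_simp
    ring
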